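/- Fix an integer n ≥ 1, set kₙ = nπ, and let ε > 0 be sufficiently small. Set γₙ = −ε·kₙ⁴ + (18/ε)·kₙ². Then there exist δ > 0, a continuous function γ : (−δ,δ) → ℝ with γ(0) = γₙ, a function η : (−δ,δ) → [0,∞) with η(s) → 0 as s → 0, and for each s ∈ (−δ,δ) twice continuously differentiable functions φₛ, uₛ : [-1,1] → ℝ such that: (i) ε·φₛ''(x) − (1/ε)·W'(φₛ(x)) − γ(s)·uₛ(x) = 0 for all x ∈ (−1,1), where W'(t) = 36(2t³ − 3t² + t); (ii) −uₛ''(x) = φₛ(x) − (1/2)∫_{-1}^{1} φₛ(y) dy for all x ∈ (−1,1); (iii) φₛ'(±1) = 0, uₛ'(±1) = 0, and ∫_{-1}^{1} uₛ(x) dx = 0; and (iv) sup_{x ∈ [-1,1]} |φₛ(x) − 1/2 − s·cos(kₙ x)| ≤ η(s)·|s|. -/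

import Mathlib

open Topology Filter

namespace ACOK

section Abstract
variable {X : Type*} [NormedCommRing X] [NormedAlgebra ℝ X] [CompleteSpace X]

theorem isInvertible_of_compact (D K : X →L[ℝ] X) (hK : IsCompactOperator K)
    (hD : D = ContinuousLinearMap.id ℝ X - K) (hinj : ∀ z, D z = 0 → z = 0) :
    D.IsInvertible := by
  have h := hK.hasEigenvalue_or_mem_resolventSet (μ := (1:ℝ)) one_ne_zero
  rcases h with h | h
  · obtain ⟨v, hv⟩ := h.exists_hasEigenvector
    exfalso
    apply hv.2
    apply hinj
    have := hv.apply_eq_smul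
    simp at this
    simp [hD, this]
  · rw [spectrum.mem_resolventSet_iff] at h
    have e : (algebraMap ℝ (X →L[ℝ] X)) 1 - K = D := by
      rw [hD]; ext; simp
    rw [e, ContinuousLinearMap.isUnit_iff_bijective] at h
    exact ⟨ContinuousLinearEquiv.ofBijective D (LinearMap.ker_eq_bot.2 h.1) (LinearMap.range_eq_top.2 h.2), by ext; simp⟩

theorem abstract_branch (T : X →L[ℝ] X) (hT : IsCompactOperator T) (c e : X)
    (l₁ l₂ : X →L[ℝ] ℝ) (a r : ℝ)
    (hc : T c = c) (h1T : ∀ x, l₁ (T x) = l₁ x) (h1c : l₁ c = 1) (h1c3 : l₁ (c * c * c) = 3 / 4)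
    (h1e : l₁ e = 0) (h2T : ∀ x, l₂ (T x) = r * l₂ x) (h2c : l₂ c = 0) (h2c3 : l₂ (c * c * c) = 0)
    (hr : 1 - a * r + (a - 1) * r ^ 2 = 0)
    (hcase : (e = 0 ∧ l₂ = 0) ∨ (l₂ e = 1 ∧ -3 * a * r ^ 2 + 12 * a * r * l₂ (c * c * e) ≠ 0))
    (hker : ∀ w, w - a • T w + (a - 1) • T (T w) = 0 → l₁ w = 0 → ∃ b : ℝ, w = b • e) :
    ∃ δ > (0 : ℝ), ∃ ν : ℝ → ℝ, ∃ w : ℝ → X, ContinuousOn ν (Set.Ioo (-δ) δ) ∧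
      w 0 = 0 ∧ ContinuousAt w 0 ∧
      ∀ s ∈ Set.Ioo (-δ) δ, ∀ V : X, V = s • (c + w s) →
        V = T (a • V - (4 * a) • (V * V * V) - (a - 1 + s ^ 2 * ν s) • T V) := by
  let Q : X →L[ℝ] X := ContinuousLinearMap.id ℝ X - l₁.smulRight c
  let A : X →L[ℝ] X := ContinuousLinearMap.id ℝ X - a • T + (a - 1) • (T ∘L T)
  let Pi : X →L[ℝ] X := l₁.smulRight c + l₂.smulRight e
  let M : X → X := fun z => (l₁ z) • T (T (c + Q z))
      + (4 * a) • T ((c + Q z) * (c + Q z) * (c + Q z))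
  let F : ℝ × X → X := fun p => A (Q p.2) + (p.1 • M p.2 + (1 - p.1) • Pi (M p.2))
  let z0 : X := (-3 * a) • c
  have hM : ContDiff ℝ 1 M := by
    have h3 : ContDiff ℝ 1 (fun z : X => (c + Q z)) := by fun_prop
    have h4 : ContDiff ℝ 1 (fun z : X => T ((c + Q z) * (c + Q z) * (c + Q z))) :=
      T.contDiff.comp ((h3.mul h3).mul h3)
    have h5 : ContDiff ℝ 1 (fun z : X => (4 * a) • T ((c + Q z) * (c + Q z) * (c + Q z))) :=
      h4.const_smul (4 * a)
    exact (l₁.contDiff.smul (by fun_prop)).add h5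
  have hF : ContDiff ℝ 1 F := by
    have : ContDiff ℝ 1 (fun p : ℝ × X => M p.2) := hM.comp contDiff_snd
    have h2 : ContDiff ℝ 1 (fun p : ℝ × X => Pi (M p.2)) := Pi.contDiff.comp this
    have h3 : ContDiff ℝ 1 (fun p : ℝ × X => A (Q p.2)) := by fun_prop
    exact h3.add ((contDiff_fst.smul this).add ((contDiff_const.sub contDiff_fst).smul h2))
  have hQz0 : Q z0 = 0 := by simp [Q, z0, h1c]
  have hlz0 : l₁ z0 = -3 * a := by simp [z0, h1c]
  have hPiM0 : Pi (M z0) = 0 := by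
    simp [Pi, M, hQz0, hlz0, hc, h1T, h2T, h1c, h2c, h1c3, h2c3]
    left; ring
  let N : X →L[ℝ] X := l₁.smulRight c + ((-3 * a) • (T ∘L T ∘L Q)
     + (12 * a) • (T ∘L (ContinuousLinearMap.mul ℝ X (c * c)) ∘L Q))
  have hMd : HasFDerivAt M N z0 := by
    have h3 : HasFDerivAt (fun z : X => (c + Q z)) Q z0 := Q.hasFDerivAt.const_add c
    have := (l₁.hasFDerivAt (x := z0)).smul (((T ∘L T).hasFDerivAt).comp z0 h3)
    have h4 := (((T.hasFDerivAt).comp z0 ((h3.mul h3).mul h3)).const_smul (4 * a))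
    refine (this.add h4).congr_fderiv ?_
    ext z
    simp [N, hQz0, hlz0, hc, h1T, h1c]
    rw [← mul_assoc]
    module
  let D : X →L[ℝ] X := A ∘L Q + Pi ∘L N
  have hG : HasFDerivAt (fun z => F (0, z)) D z0 := by
    have := ((A ∘L Q).hasFDerivAt (x := z0)).add ((Pi.hasFDerivAt).comp z0 hMd)
    refine this.congr_of_eventuallyEq (Eventually.of_forall fun z => ?_)
    simp [F]
  have hDeq : fderiv ℝ F (0, z0) ∘L .inr ℝ ℝ X = D := by
    have h1 : HasFDerivAt F (fderiv ℝ F (0, z0)) (0, z0) :=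
      (hF.differentiable one_ne_zero _).hasFDerivAt
    have h2 : HasFDerivAt (fun z : X => ((0:ℝ), z)) (.inr ℝ ℝ X) z0 := hasFDerivAt_prodMk_right 0 z0
    exact (h1.comp z0 h2).unique hG
  have hl1A : ∀ x, l₁ (A x) = 0 := by intro x; simp [A, h1T]; ring
  have hl2A : ∀ x, l₂ (A x) = 0 := by
    intro x; simp [A, h2T]; linear_combination (l₂ x) * hr
  have hAc : A c = 0 := by simp [A, hc]; module
  have hsolve : ∀ x y, A x + Pi y = 0 → A x = 0 ∧ l₁ y = 0 ∧ l₂ y = 0 := by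
    intro x y h
    have h1 := congrArg l₁ h
    have h2 := congrArg l₂ h
    simp [hl1A, Pi, h1c, h1e] at h1
    have h2' : l₂ y = 0 := by
      rcases hcase with hh | hh
      · simp [hh.2]
      · simpa [hl2A, Pi, h2c, hh.1] using h2
    refine ⟨?_, h1, h2'⟩
    simpa [Pi, h1, h2'] using h
  have hinj : ∀ z, D z = 0 → z = 0 := by
    intro z hz
    obtain ⟨h1, h2, h3⟩ := hsolve (Q z) (N z) (by simpa [D] using hz)
    have hl1Q : l₁ (Q z) = 0 := by simp [Q, h1c]
    obtain ⟨b, hb⟩ := hker (Q z) (by simpa [A] using h1) hl1Q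
    have hQ0 : Q z = 0 := by
      rcases hcase with hh | hh
      · rw [hb, hh.1, smul_zero]
      · simp [N, h2T, h2c, hb, hh.1] at h3
        have : b * (-3 * a * r ^ 2 + 12 * a * r * l₂ (c * c * e)) = 0 := by
          linear_combination h3
        rcases mul_eq_zero.1 this with h | h
        · rw [hb, h, zero_smul]
        · exact absurd h hh.2
    have : l₁ z = 0 := by simpa [N, h1T, h1c, hQ0] using h2
    simpa [Q, this] using hQ0
  have hinv : D.IsInvertible := by
    refine isInvertible_of_compact D (l₁.smulRight c + (a • (T ∘L Q) - (a - 1) • (T ∘L T ∘L Q))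
      - (l₁ ∘L N).smulRight c - (l₂ ∘L N).smulRight e) ?_ ?_ hinj
    · have fr : ∀ (l : X →L[ℝ] ℝ) (y : X), IsCompactOperator (l.smulRight y) := by
        intro l y
        have h1 : IsCompactOperator (ContinuousLinearMap.toSpanSingleton ℝ y) :=
          isCompactOperator_of_locallyCompactSpace_rng (ContinuousLinearMap.toSpanSingleton ℝ y)
        exact h1.comp_clm l
      have hTQ : IsCompactOperator (T ∘L Q) := hT.comp_clm Q
      have hTTQ : IsCompactOperator (T ∘L T ∘L Q) := hT.comp_clm (T ∘L Q)
      exact (((fr l₁ c).add ((hTQ.smul a).sub (hTTQ.smul (a - 1)))).sub (fr _ c)).sub (fr _ e)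
    · ext z
      simp [D, A, Pi, Q]
      module
  have cd : ContDiffAt ℝ 1 F (0, z0) := hF.contDiffAt
  have hinv' : (fderiv ℝ F (0, z0) ∘L .inr ℝ ℝ X).IsInvertible := by rw [hDeq]; exact hinv
  let ψ := cd.implicitFunction one_ne_zero hinv'
  have hψ0 : ψ 0 = z0 := cd.implicitFunction_apply_self one_ne_zero hinv'
  have hψc : ∀ᶠ x in 𝓝 (0:ℝ), ContinuousAt ψ x := by
    have := (cd.contDiffAt_implicitFunction one_ne_zero hinv').eventually (by simp)
    exact this.mono fun x hx => hx.continuousAt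
  have hψF : ∀ᶠ x in 𝓝 (0:ℝ), F (x, ψ x) = 0 := by
    have h0 : F (0, z0) = 0 := by simp [F, hQz0, hPiM0]
    have := cd.eventually_apply_implicitFunction one_ne_zero hinv'
    rwa [h0] at this
  have hsq : Tendsto (fun s : ℝ => s ^ 2) (𝓝 0) (𝓝 0) := by
    have : Continuous (fun s : ℝ => s ^ 2) := by fun_prop
    simpa using this.tendsto 0
  obtain ⟨δ, hδ, hb⟩ := Metric.eventually_nhds_iff.1 (hsq.eventually (hψc.and hψF))
  refine ⟨δ, hδ, fun s => l₁ (ψ (s ^ 2)), fun s => Q (ψ (s ^ 2)), ?_, ?_, ?_, ?_⟩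
  · intro s hs
    have := (hb (y := s) (by simpa [abs_lt] using hs)).1
    apply ContinuousAt.continuousWithinAt
    exact l₁.continuous.continuousAt.comp
      (ContinuousAt.comp (f := fun s : ℝ => s ^ 2) this (by fun_prop))
  · simp [hψ0, hQz0]
  · have := (hb (y := 0) (by simpa using hδ)).1
    exact Q.continuous.continuousAt.comp
      (ContinuousAt.comp (f := fun s : ℝ => s ^ 2) this (by fun_prop))
  · intro s hs V hV
    have h := (hb (y := s) (by simpa [abs_lt] using hs)).2
    set z := ψ (s ^ 2) with hz
    set w := Q z with hw
    have h' : A w + (s ^ 2 • M z + (1 - s ^ 2) • Pi (M z)) = 0 := h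
    have hPi0 : Pi (M z) = 0 := by
      have h1 := congrArg l₁ h'
      have h2 := congrArg l₂ h'
      have h1' : l₁ (M z) = 0 := by
        simp [hl1A, Pi, h1c, h1e] at h1
        linear_combination h1
      have h2' : l₂ (M z) = 0 := by
        rcases hcase with hh | hh
        · simp [hh.2]
        · simp [hl2A, Pi, h2c, hh.1] at h2
          linear_combination h2
      simp [Pi, h1', h2']
    have hmain : A (c + w) + s ^ 2 • M z = 0 := by
      rw [map_add, hAc, zero_add]; simpa [hPi0] using h'
    set y := c + w with hy
    have hMz : M z = (l₁ z) • T (T y) + (4 * a) • T (y * y * y) := rfl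
    have hAy : A y = y - a • T y + (a - 1) • T (T y) := by simp [A]
    rw [hMz, hAy] at hmain
    subst hV
    have e3 : (s • y) * (s • y) * (s • y) = s ^ 3 • (y * y * y) := by
      simp only [smul_mul_assoc, mul_smul_comm, smul_smul]; congr 1; ring
    rw [e3]
    simp only [map_sub, map_smul, smul_smul]
    have := congrArg (fun x => s • x) hmain
    simp only [smul_zero] at this
    rw [← sub_eq_zero, ← this]
    module

end Abstract
end ACOK
namespace ACOK

theorem hpi : (0:ℝ) ≤ Real.pi / 2 := by positivity

abbrev Y := BoundedContinuousFunction (Set.Icc (0:ℝ) (Real.pi / 2)) ℝ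

noncomputable def ex (f : Y) : ℝ → ℝ := Set.IccExtend hpi f

theorem ex_cont (f : Y) : Continuous (ex f) := f.continuous.Icc_extend'

theorem ex_of_mem (f : Y) {x : ℝ} (hx : x ∈ Set.Icc (0:ℝ) (Real.pi / 2)) : ex f x = f ⟨x, hx⟩ :=
  Set.IccExtend_of_mem hpi f hx

theorem ex_le (f : Y) (x : ℝ) : |ex f x| ≤ ‖f‖ := f.norm_coe_le_norm _

theorem ex_add (f g : Y) (x : ℝ) : ex (f + g) x = ex f x + ex g x := rfl
theorem ex_sub (f g : Y) (x : ℝ) : ex (f - g) x = ex f x - ex g x := rfl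
theorem ex_smul (r : ℝ) (f : Y) (x : ℝ) : ex (r • f) x = r * ex f x := rfl
theorem ex_mul (f g : Y) (x : ℝ) : ex (f * g) x = ex f x * ex g x := rfl

noncomputable def prim (g : ℝ → ℝ) (x : ℝ) : ℝ := ∫ z in (0:ℝ)..x, g z

noncomputable def Tf (g : ℝ → ℝ) (x : ℝ) : ℝ := ∫ y in x..(Real.pi / 2), prim g y

theorem prim_deriv {g : ℝ → ℝ} (hg : Continuous g) (x : ℝ) : HasDerivAt (prim g) (g x) x :=
  intervalIntegral.integral_hasDerivAt_right (hg.intervalIntegrable _ _)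
    (hg.stronglyMeasurableAtFilter _ _) hg.continuousAt

theorem prim_cont {g : ℝ → ℝ} (hg : Continuous g) : Continuous (prim g) :=
  continuous_iff_continuousAt.2 fun x => (prim_deriv hg x).continuousAt

theorem Tf_deriv {g : ℝ → ℝ} (hg : Continuous g) (x : ℝ) : HasDerivAt (Tf g) (-prim g x) x :=
  intervalIntegral.integral_hasDerivAt_left ((prim_cont hg).intervalIntegrable _ _)
    ((prim_cont hg).stronglyMeasurableAtFilter _ _) (prim_cont hg).continuousAt

theorem Tf_cont {g : ℝ → ℝ} (hg : Continuous g) : Continuous (Tf g) :=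
  continuous_iff_continuousAt.2 fun x => (Tf_deriv hg x).continuousAt

theorem prim_zero (g : ℝ → ℝ) : prim g 0 = 0 := by simp [prim]
theorem Tf_end (g : ℝ → ℝ) : Tf g (Real.pi / 2) = 0 := by simp [Tf]

theorem prim_add {f g : ℝ → ℝ} (hf : Continuous f) (hg : Continuous g) (x : ℝ) :
    prim (fun y => f y + g y) x = prim f x + prim g x :=
  intervalIntegral.integral_add (hf.intervalIntegrable _ _) (hg.intervalIntegrable _ _)

theorem Tf_add {f g : ℝ → ℝ} (hf : Continuous f) (hg : Continuous g) (x : ℝ) :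
    Tf (fun y => f y + g y) x = Tf f x + Tf g x := by
  simp only [Tf, prim_add hf hg]
  exact intervalIntegral.integral_add ((prim_cont hf).intervalIntegrable _ _)
    ((prim_cont hg).intervalIntegrable _ _)

theorem Tf_smul {f : ℝ → ℝ} (r : ℝ) (x : ℝ) :
    Tf (fun y => r * f y) x = r * Tf f x := by
  simp [Tf, prim]

theorem prim_bound {g : ℝ → ℝ} {C : ℝ} (hC : ∀ x, |g x| ≤ C) {x : ℝ}
    (hx : x ∈ Set.Icc (0:ℝ) (Real.pi / 2)) : |prim g x| ≤ C * (Real.pi / 2) := by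
  have h := intervalIntegral.norm_integral_le_of_norm_le_const (a := 0) (b := x) (f := g) (C := C)
    (fun y _ => hC y)
  have h0 : 0 ≤ C := (abs_nonneg _).trans (hC 0)
  rw [sub_zero, abs_of_nonneg hx.1] at h
  exact h.trans (by gcongr; exact hx.2)

theorem Tf_lip {g : ℝ → ℝ} (hg : Continuous g) {C : ℝ} (hC : ∀ x, |g x| ≤ C) {x y : ℝ}
    (hx : x ∈ Set.Icc (0:ℝ) (Real.pi / 2)) (hy : y ∈ Set.Icc (0:ℝ) (Real.pi / 2)) :
    |Tf g x - Tf g y| ≤ C * (Real.pi / 2) * |x - y| :=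
  (convex_Icc (0:ℝ) (Real.pi / 2)).norm_image_sub_le_of_norm_hasDerivWithin_le (f := Tf g)
    (fun z _ => (Tf_deriv hg z).hasDerivWithinAt)
    (fun z hz => by rw [norm_neg]; exact prim_bound hC hz) hy hx

theorem Tf_bound {g : ℝ → ℝ} (hg : Continuous g) {C : ℝ} (hC : ∀ x, |g x| ≤ C) {x : ℝ}
    (hx : x ∈ Set.Icc (0:ℝ) (Real.pi / 2)) :
    |Tf g x| ≤ (Real.pi / 2) * (Real.pi / 2) * C := by
  have h := Tf_lip hg hC hx (Set.right_mem_Icc.2 hpi)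
  rw [Tf_end, sub_zero] at h
  have h0 : 0 ≤ C := (abs_nonneg _).trans (hC 0)
  have : |x - Real.pi / 2| ≤ Real.pi / 2 := by
    rw [abs_le]; constructor <;> linarith [hx.1, hx.2]
  calc _ ≤ _ := h
    _ ≤ C * (Real.pi / 2) * (Real.pi / 2) := by gcongr
    _ = _ := by ring

noncomputable def mk (g : ℝ → ℝ) (hg : Continuous g) : Y :=
  BoundedContinuousFunction.mkOfCompact ⟨fun x => g x, hg.comp continuous_subtype_val⟩

theorem mk_apply (g : ℝ → ℝ) (hg : Continuous g) (x : Set.Icc (0:ℝ) (Real.pi / 2)) :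
    mk g hg x = g x := rfl

theorem ex_mk (g : ℝ → ℝ) (hg : Continuous g) {x : ℝ} (hx : x ∈ Set.Icc (0:ℝ) (Real.pi / 2)) :
    ex (mk g hg) x = g x := by rw [ex_of_mem _ hx, mk_apply]

noncomputable def T : Y →L[ℝ] Y :=
  LinearMap.mkContinuous
    { toFun := fun f => mk (Tf (ex f)) (Tf_cont (ex_cont f))
      map_add' := fun f g => by
        ext x
        exact Tf_add (ex_cont f) (ex_cont g) x
      map_smul' := fun r f => by
        ext x
        exact Tf_smul r x }
    ((Real.pi / 2) * (Real.pi / 2))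
    (fun f => by
      rw [BoundedContinuousFunction.norm_le (by positivity)]
      intro x
      exact Tf_bound (ex_cont f) (ex_le f) x.2)

theorem T_apply (f : Y) (x : Set.Icc (0:ℝ) (Real.pi / 2)) : T f x = Tf (ex f) x := rfl

theorem ex_T (f : Y) {x : ℝ} (hx : x ∈ Set.Icc (0:ℝ) (Real.pi / 2)) :
    ex (T f) x = Tf (ex f) x := by rw [ex_of_mem _ hx, T_apply]

theorem T_compact : IsCompactOperator T := by
  refine (isCompactOperator_iff_isCompact_closure_image_closedBall (T : Y →ₗ[ℝ] Y)
    (zero_lt_one)).2 ?_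
  refine BoundedContinuousFunction.arzela_ascoli
    (Set.Icc (-((Real.pi / 2) * (Real.pi / 2))) ((Real.pi / 2) * (Real.pi / 2)))
    isCompact_Icc _ ?_ ?_
  · rintro f x ⟨g, hg, rfl⟩
    rw [mem_closedBall_zero_iff] at hg
    have := Tf_bound (ex_cont g) (fun x => (ex_le g x).trans hg) x.2
    rw [mul_one] at this
    exact abs_le.1 this
  · apply UniformEquicontinuous.equicontinuous
    refine LipschitzWith.uniformEquicontinuous _ (Real.toNNReal (Real.pi / 2)) ?_
    rintro ⟨f, g, hg, rfl⟩
    rw [mem_closedBall_zero_iff] at hg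
    refine LipschitzWith.of_dist_le_mul fun x y => ?_
    have := Tf_lip (ex_cont g) (fun x => (ex_le g x).trans hg) x.2 y.2
    rw [one_mul] at this
    rw [Real.coe_toNNReal _ hpi, Subtype.dist_eq, Real.dist_eq, Real.dist_eq]
    exact this

noncomputable def ell (q : ℝ) : Y →L[ℝ] ℝ :=
  LinearMap.mkContinuous
    { toFun := fun f => (4 / Real.pi) * ∫ x in (0:ℝ)..(Real.pi / 2), ex f x * Real.cos (q * x)
      map_add' := fun f g => by
        simp only [ex_add, add_mul]
        rw [intervalIntegral.integral_add, mul_add]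
        · exact ((ex_cont f).mul (by fun_prop)).intervalIntegrable _ _
        · exact ((ex_cont g).mul (by fun_prop)).intervalIntegrable _ _
      map_smul' := fun r f => by
        simp only [ex_smul, mul_assoc]
        rw [intervalIntegral.integral_const_mul]
        simp; ring }
    2
    (fun f => by
      have h := intervalIntegral.norm_integral_le_of_norm_le_const (a := 0) (b := Real.pi / 2)
        (f := fun x => ex f x * Real.cos (q * x)) (C := ‖f‖) (fun x _ => by
          rw [norm_mul]
          have h1 := ex_le f x
          have h2 := Real.abs_cos_le_one (q * x)
          calc _ ≤ ‖f‖ * 1 := mul_le_mul h1 h2 (abs_nonneg _) (norm_nonneg _)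
            _ = _ := mul_one _)
      rw [sub_zero, abs_of_nonneg hpi] at h
      have hp := Real.pi_pos
      simp only [LinearMap.coe_mk, AddHom.coe_mk]
      rw [norm_mul, Real.norm_of_nonneg (by positivity : 0 ≤ 4 / Real.pi)]
      calc _ ≤ 4 / Real.pi * (‖f‖ * (Real.pi / 2)) := by gcongr
        _ = 2 * ‖f‖ := by field_simp; ring)

theorem ell_apply (q : ℝ) (f : Y) :
    ell q f = (4 / Real.pi) * ∫ x in (0:ℝ)..(Real.pi / 2), ex f x * Real.cos (q * x) := rfl

theorem ell_of_eq (q : ℝ) (f : Y) (g : ℝ → ℝ)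
    (h : ∀ x ∈ Set.Icc (0:ℝ) (Real.pi / 2), ex f x = g x) :
    ell q f = (4 / Real.pi) * ∫ x in (0:ℝ)..(Real.pi / 2), g x * Real.cos (q * x) := by
  rw [ell_apply]
  congr 1
  apply intervalIntegral.integral_congr
  intro x hx
  rw [Set.uIcc_of_le hpi] at hx
  simp [h x hx]

theorem ell_T (q : ℝ) (hq0 : q ≠ 0) (hq : Real.cos (q * (Real.pi / 2)) = 0) (f : Y) :
    ell q (T f) = (q ^ 2)⁻¹ * ell q f := by
  rw [ell_of_eq q (T f) _ (fun x hx => ex_T f hx), ell_apply]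
  have hc := ex_cont f
  have key : ∫ x in (0:ℝ)..(Real.pi / 2), (Tf (ex f) x * Real.cos (q * x)
      - (q ^ 2)⁻¹ * (ex f x * Real.cos (q * x))) =
      (Tf (ex f) (Real.pi / 2) * (Real.sin (q * (Real.pi / 2)) / q)
        - prim (ex f) (Real.pi / 2) * (Real.cos (q * (Real.pi / 2)) / q ^ 2))
      - (Tf (ex f) 0 * (Real.sin (q * 0) / q) - prim (ex f) 0 * (Real.cos (q * 0) / q ^ 2)) := by
    apply intervalIntegral.integral_eq_sub_of_hasDerivAt
      (f := fun x => Tf (ex f) x * (Real.sin (q * x) / q)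
        - prim (ex f) x * (Real.cos (q * x) / q ^ 2))
    · intro x _
      have hlin : HasDerivAt (fun x : ℝ => q * x) q x := by
        simpa using (hasDerivAt_id x).const_mul q
      have h1 := (Tf_deriv hc x).mul ((hlin.sin).div_const q)
      have h2 := (prim_deriv hc x).mul ((hlin.cos).div_const (q ^ 2))
      convert! h1.sub h2 using 1
      field_simp
      ring
    · apply Continuous.intervalIntegrable
      have := Tf_cont hc
      fun_prop
  rw [Tf_end, hq, prim_zero, intervalIntegral.integral_sub] at key
  · rw [intervalIntegral.integral_const_mul] at key
    simp at key
    have := sub_eq_zero.1 key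
    rw [this]; ring
  · apply Continuous.intervalIntegrable
    have := Tf_cont hc
    fun_prop
  · apply Continuous.intervalIntegrable
    fun_prop

noncomputable def cs (q : ℝ) : Y := mk (fun x => Real.cos (q * x)) (by fun_prop)

theorem ex_cs (q : ℝ) {x : ℝ} (hx : x ∈ Set.Icc (0:ℝ) (Real.pi / 2)) :
    ex (cs q) x = Real.cos (q * x) := ex_mk _ _ hx

theorem prim_cs {x : ℝ} (hx : x ∈ Set.Icc (0:ℝ) (Real.pi / 2)) :
    prim (ex (cs 1)) x = Real.sin x := by
  have : prim (ex (cs 1)) x = ∫ z in (0:ℝ)..x, Real.cos z := by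
    apply intervalIntegral.integral_congr
    intro z hz
    rw [Set.uIcc_of_le hx.1] at hz
    simpa using ex_cs 1 ⟨hz.1, hz.2.trans hx.2⟩
  rw [this]; simp

theorem T_cs : T (cs 1) = cs 1 := by
  ext ⟨x, hx⟩
  rw [T_apply]
  have : Tf (ex (cs 1)) x = ∫ y in x..(Real.pi / 2), Real.sin y := by
    apply intervalIntegral.integral_congr
    intro z hz
    rw [Set.uIcc_of_le hx.2] at hz
    exact prim_cs ⟨hx.1.trans hz.1, hz.2⟩
  rw [this]; simp [cs, mk_apply]

/-- kernel of `1 - q² T` -/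
theorem ker_T (q : ℝ) (hq0 : q ≠ 0) (w : Y) (hw : w = (q ^ 2) • T w) :
    ∃ b : ℝ, w = b • cs q ∧ b * Real.cos (q * (Real.pi / 2)) = 0 := by
  have hc := ex_cont w
  have hwx : ∀ x ∈ Set.Icc (0:ℝ) (Real.pi / 2), ex w x = q ^ 2 * Tf (ex w) x := by
    intro x hx
    rw [← ex_T w hx, ← ex_smul, ← hw]
  let W : ℝ → ℝ := fun x => q ^ 2 * Tf (ex w) x
  let b := W 0
  have hlin : ∀ x, HasDerivAt (fun x : ℝ => q * x) q x := fun x => by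
    simpa using (hasDerivAt_id x).const_mul q
  have hW : ∀ x, HasDerivAt W (q ^ 2 * (-prim (ex w) x)) x := fun x =>
    (Tf_deriv hc x).const_mul _
  have hD : ∀ x, HasDerivAt (fun x => W x - b * Real.cos (q * x))
      (q ^ 2 * (-prim (ex w) x) - b * (-Real.sin (q * x) * q)) x := fun x =>
    (hW x).sub (((hlin x).cos).const_mul b)
  have hD' : ∀ x, HasDerivAt (fun x => q ^ 2 * (-prim (ex w) x) - b * (-Real.sin (q * x) * q))
      (q ^ 2 * (-(ex w x)) - b * (-(Real.cos (q * x) * q) * q)) x := fun x =>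
    (((prim_deriv hc x).neg).const_mul _).sub
      ((((hlin x).sin.neg).mul_const q).const_mul b)
  let E : ℝ → ℝ := fun x => (q ^ 2 * (-prim (ex w) x) - b * (-Real.sin (q * x) * q)) ^ 2
    + q ^ 2 * (W x - b * Real.cos (q * x)) ^ 2
  have hE : ∀ x ∈ Set.Icc (0:ℝ) (Real.pi / 2), HasDerivAt E 0 x := by
    intro x hx
    have := ((hD' x).pow 2).add (((hD x).pow 2).const_mul (q ^ 2))
    convert! this using 1
    have hh : ex w x = W x := hwx x hx
    simp only [Nat.cast_ofNat, hh]
    ring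
  have hE0 : ∀ x ∈ Set.Icc (0:ℝ) (Real.pi / 2), E x = E 0 :=
    constant_of_has_deriv_right_zero (fun x hx => (hE x hx).continuousAt.continuousWithinAt)
      (fun x hx => (hE x ⟨hx.1, hx.2.le⟩).hasDerivWithinAt)
  have hE00 : E 0 = 0 := by simp [E, prim_zero, b]
  have hWx : ∀ x ∈ Set.Icc (0:ℝ) (Real.pi / 2), W x = b * Real.cos (q * x) := by
    intro x hx
    have h := hE0 x hx
    rw [hE00] at h
    have h1 : q ^ 2 * (W x - b * Real.cos (q * x)) ^ 2 = 0 := by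
      have : 0 ≤ (q ^ 2 * (-prim (ex w) x) - b * (-Real.sin (q * x) * q)) ^ 2 := sq_nonneg _
      have : 0 ≤ q ^ 2 * (W x - b * Real.cos (q * x)) ^ 2 := by positivity
      simp only [E] at h
      linarith
    have h2 : W x - b * Real.cos (q * x) = 0 := by
      simpa [hq0] using h1
    linarith
  refine ⟨b, ?_, ?_⟩
  · ext ⟨x, hx⟩
    rw [← ex_of_mem w hx, hwx x hx]
    exact hWx x hx
  · rw [← hWx _ (Set.right_mem_Icc.2 hpi)]
    simp [W, Tf_end]

end ACOK
namespace ACOK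

theorem int_cos_even (m : ℤ) (hm : m ≠ 0) :
    ∫ x in (0:ℝ)..(Real.pi / 2), Real.cos ((2 * m : ℝ) * x) = 0 := by
  have h : (2 * m : ℝ) ≠ 0 := by
    have : (m : ℝ) ≠ 0 := by exact_mod_cast hm
    positivity
  rw [intervalIntegral.integral_comp_mul_left (fun x => Real.cos x) h]
  have : (2 * m : ℝ) * (Real.pi / 2) = m * Real.pi := by ring
  simp [this]

theorem int_lin (a b c d : ℝ) (i j k : ℤ) (hi : i ≠ 0) (hj : j ≠ 0) (hk : k ≠ 0) :
    ∫ x in (0:ℝ)..(Real.pi / 2), (a + b * Real.cos ((2 * i : ℝ) * x)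
      + c * Real.cos ((2 * j : ℝ) * x) + d * Real.cos ((2 * k : ℝ) * x)) = a * (Real.pi / 2) := by
  rw [intervalIntegral.integral_add, intervalIntegral.integral_add, intervalIntegral.integral_add]
  · simp only [intervalIntegral.integral_const_mul, int_cos_even _ hi, int_cos_even _ hj,
      int_cos_even _ hk]
    simp; ring
  all_goals apply Continuous.intervalIntegrable; fun_prop

theorem ell_eval (q : ℝ) (f : Y) (a b c d : ℝ) (i j k : ℤ) (hi : i ≠ 0) (hj : j ≠ 0) (hk : k ≠ 0)
    (h : ∀ x ∈ Set.Icc (0:ℝ) (Real.pi / 2), ex f x * Real.cos (q * x) =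
      a + b * Real.cos ((2 * i : ℝ) * x)
      + c * Real.cos ((2 * j : ℝ) * x) + d * Real.cos ((2 * k : ℝ) * x)) :
    ell q f = 2 * a := by
  rw [ell_apply]
  have : ∫ x in (0:ℝ)..(Real.pi / 2), ex f x * Real.cos (q * x) = a * (Real.pi / 2) := by
    rw [← int_lin a b c d i j k hi hj hk]
    apply intervalIntegral.integral_congr
    intro x hx
    rw [Set.uIcc_of_le hpi] at hx
    exact h x hx
  rw [this]
  field_simp
  ring

theorem pcos (x y : ℝ) : Real.cos x * Real.cos y = (Real.cos (x + y) + Real.cos (x - y)) / 2 := by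
  rw [Real.cos_add, Real.cos_sub]; ring

theorem ell1_c : ell 1 (cs 1) = 1 := by
  rw [ell_eval 1 _ (1/2) (1/2) 0 0 1 1 1 (by simp) (by simp) (by simp)]
  · norm_num
  · intro x hx
    rw [ex_cs _ hx, pcos]
    simp; ring_nf

theorem ell1_c3 : ell 1 (cs 1 * cs 1 * cs 1) = 3 / 4 := by
  rw [ell_eval 1 _ (3/8) (1/2) (1/8) 0 1 2 1 (by simp) (by simp) (by simp)]
  · norm_num
  · intro x hx
    simp only [ex_mul, ex_cs _ hx]
    have h1 : Real.cos (2 * x) = 2 * Real.cos x ^ 2 - 1 := Real.cos_two_mul x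
    have h2 : Real.cos (4 * x) = 2 * Real.cos (2 * x) ^ 2 - 1 := by
      rw [← Real.cos_two_mul]; ring_nf
    norm_num
    rw [h2, h1]; ring

theorem ell_one_cs (j : ℤ) (hj : 2 ≤ j) : ell 1 (cs (2 * j + 1)) = 0 := by
  rw [ell_eval 1 _ 0 (1/2) (1/2) 0 (j + 1) j 1 (by omega) (by omega) (by simp)]
  · norm_num
  · intro x hx
    rw [ex_cs _ hx, pcos]
    push_cast; ring_nf

theorem ell_cs_one (j : ℤ) (hj : 2 ≤ j) : ell (2 * j + 1) (cs 1) = 0 := by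
  rw [ell_eval _ _ 0 (1/2) (1/2) 0 (j + 1) j 1 (by omega) (by omega) (by simp)]
  · norm_num
  · intro x hx
    rw [ex_cs _ hx, mul_comm, pcos]
    push_cast; ring_nf

theorem cos_cubed (x : ℝ) : Real.cos x * Real.cos x * Real.cos x =
    (3 * Real.cos x + Real.cos (3 * x)) / 4 := by
  rw [Real.cos_three_mul]; ring

theorem ell_c3 (j : ℤ) (hj : 2 ≤ j) : ell (2 * j + 1) (cs 1 * cs 1 * cs 1) = 0 := by
  have h3 : ell (2 * j + 1) (cs 3) = 0 := by
    rw [ell_eval _ _ 0 (1/2) (1/2) 0 (j + 2) (j - 1) 1 (by omega) (by omega) (by simp)]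
    · norm_num
    · intro x hx
      rw [ex_cs _ hx, mul_comm, pcos]
      push_cast; ring_nf
  have : cs 1 * cs 1 * cs 1 = (3 / 4 : ℝ) • cs 1 + (1 / 4 : ℝ) • cs 3 := by
    ext ⟨x, hx⟩
    have := cos_cubed x
    simp [cs, mk_apply, this]
    ring
  rw [this, map_add, map_smul, map_smul, h3, ell_cs_one j hj]
  simp

theorem ell_cs (j : ℤ) (hj : 2 ≤ j) : ell (2 * j + 1) (cs (2 * j + 1)) = 1 := by
  rw [ell_eval _ _ (1/2) (1/2) 0 0 (2 * j + 1) 1 1 (by omega) (by omega) (by simp)]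
  · norm_num
  · intro x hx
    rw [ex_cs _ hx, pcos]
    push_cast; simp; ring_nf

theorem ell_ccs (j : ℤ) (hj : 2 ≤ j) : ell (2 * j + 1) (cs 1 * cs 1 * cs (2 * j + 1)) = 1 / 2 := by
  have h3 : ell (2 * j + 1) (cs (2 * j + 3)) = 0 := by
    rw [ell_eval _ _ 0 (1/2) (1/2) 0 (2 * j + 2) 1 1 (by omega) (by omega) (by simp)]
    · norm_num
    · intro x hx
      rw [ex_cs _ hx, pcos]
      push_cast; ring_nf
  have h4 : ell (2 * j + 1) (cs (2 * j - 1)) = 0 := by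
    rw [ell_eval _ _ 0 (1/2) (1/2) 0 (2 * j) 1 1 (by omega) (by omega) (by simp)]
    · norm_num
    · intro x hx
      rw [ex_cs _ hx, mul_comm, pcos]
      push_cast; ring_nf
  have : cs 1 * cs 1 * cs (2 * j + 1) =
      (1 / 2 : ℝ) • cs (2 * j + 1) + (1 / 4 : ℝ) • cs (2 * j + 3) + (1 / 4 : ℝ) • cs (2 * j - 1) := by
    ext ⟨x, hx⟩
    have h1 : Real.cos ((2 * j + 3) * x) = Real.cos ((2 * j + 1) * x + 2 * x) := by ring_nf
    have h2 : Real.cos ((2 * j - 1) * x) = Real.cos ((2 * j + 1) * x - 2 * x) := by ring_nf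
    simp only [BoundedContinuousFunction.coe_mul, BoundedContinuousFunction.coe_add,
      BoundedContinuousFunction.coe_smul, Pi.mul_apply, Pi.add_apply, cs, mk_apply, h1, h2,
      smul_eq_mul, one_mul]
    rw [Real.cos_add _ (2 * x), Real.cos_sub _ (2 * x), Real.cos_two_mul]; ring
  rw [this, map_add, map_add, map_smul, map_smul, map_smul, h3, h4, ell_cs j hj]
  norm_num

/-- branch in `C([0,π/2])` -/
theorem branch (a : ℝ) (ha : 10 < a) :
    ∃ δ > (0 : ℝ), ∃ ν : ℝ → ℝ, ∃ w : ℝ → Y, ContinuousOn ν (Set.Ioo (-δ) δ) ∧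
      w 0 = 0 ∧ ContinuousAt w 0 ∧
      ∀ s ∈ Set.Ioo (-δ) δ, ∀ V : Y, V = s • (cs 1 + w s) →
        V = T (a • V - (4 * a) • (V * V * V) - (a - 1 + s ^ 2 * ν s) • T V) := by
  have h1T : ∀ x, ell 1 (T x) = ell 1 x := fun x => by
    rw [ell_T 1 one_ne_zero (by simp) x]; simp
  let q := Real.sqrt (a - 1)
  have hq2 : q ^ 2 = a - 1 := Real.sq_sqrt (by linarith)
  have hq3 : 3 < q := by
    apply Real.lt_sqrt_of_sq_lt; linarith
  have hq0 : q ≠ 0 := by linarith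
  have hker : ∀ w : Y, w - a • T w + (a - 1) • T (T w) = 0 → ell 1 w = 0 →
      ∃ b : ℝ, w = b • cs q ∧ b * Real.cos (q * (Real.pi / 2)) = 0 := by
    intro w hw h1
    have hy : w - (q ^ 2) • T w = 0 := by
      obtain ⟨b, hb, -⟩ := ker_T 1 one_ne_zero (w - (q ^ 2) • T w) (by
        rw [hq2, ← sub_eq_zero, ← hw]
        simp only [map_sub, map_smul]
        module)
      have h2 : ell 1 (w - (q ^ 2) • T w) = 0 := by simp [h1T, h1]
      rw [hb, map_smul, ell1_c] at h2
      have : b = 0 := by simpa using h2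
      rw [hb, this, zero_smul]
    exact ker_T q hq0 w (sub_eq_zero.1 hy)
  by_cases hres : Real.cos (q * (Real.pi / 2)) = 0
  · obtain ⟨j, hj⟩ := Real.cos_eq_zero_iff.1 hres
    have hqj : q = 2 * j + 1 := by
      have := Real.pi_pos
      have h : (q - (2 * j + 1)) * Real.pi = 0 := by linarith
      rcases mul_eq_zero.1 h with h | h
      · linarith
      · linarith
    have hj2 : 2 ≤ j := by
      have : (1:ℝ) < j := by linarith
      have : (1:ℤ) < j := by exact_mod_cast this
      omega
    refine abstract_branch T T_compact (cs 1) (cs q) (ell 1) (ell q) a (q ^ 2)⁻¹ T_cs h1T ell1_c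
      ell1_c3 ?_ (ell_T q hq0 hres) ?_ ?_ ?_ (Or.inr ⟨?_, ?_⟩) ?_
    · rw [hqj]; exact ell_one_cs j hj2
    · rw [hqj]; exact ell_cs_one j hj2
    · rw [hqj]; exact ell_c3 j hj2
    · rw [hq2]
      have : a - 1 ≠ 0 := by linarith
      field_simp; ring
    · rw [hqj]; exact ell_cs j hj2
    · have : ell q (cs 1 * cs 1 * cs q) = 1 / 2 := by rw [hqj]; exact ell_ccs j hj2
      rw [this, hq2]
      have h1 : 0 < a - 1 := by linarith
      have : -3 * a * (a - 1)⁻¹ ^ 2 + 12 * a * (a - 1)⁻¹ * (1 / 2)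
        = 3 * a * (a - 1)⁻¹ ^ 2 * (2 * (a - 1) - 1) := by field_simp; ring
      rw [this]
      have : 0 < 2 * (a - 1) - 1 := by linarith
      positivity
    · intro w hw h1
      obtain ⟨b, hb, -⟩ := hker w hw h1
      exact ⟨b, hb⟩
  · refine abstract_branch T T_compact (cs 1) 0 (ell 1) 0 a 1 T_cs h1T ell1_c
      ell1_c3 (by simp) (by simp) (by simp) (by simp) (by ring) (Or.inl ⟨rfl, rfl⟩) ?_
    intro w hw h1
    obtain ⟨b, hb, hb'⟩ := hker w hw h1
    have : b = 0 := by simpa [hres] using hb'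
    exact ⟨0, by rw [hb, this]; simp⟩

end ACOK
namespace ACOK

def Sym (G : ℝ → ℝ) : Prop := (∀ x, G (-x) = G x) ∧ ∀ x, G (x + Real.pi) = -G x

theorem Sym.periodic {G : ℝ → ℝ} (h : Sym G) : Function.Periodic G (2 * Real.pi) := by
  intro x
  have : x + 2 * Real.pi = x + Real.pi + Real.pi := by ring
  rw [this, h.2, h.2, neg_neg]

theorem Sym.arccos {G : ℝ → ℝ} (h : Sym G) (x : ℝ) : G x = G (Real.arccos (Real.cos x)) := by
  have hc : Real.cos (Real.arccos (Real.cos x)) = Real.cos x :=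
    Real.cos_arccos (Real.neg_one_le_cos x) (Real.cos_le_one x)
  obtain ⟨k, hk | hk⟩ := Real.cos_eq_cos_iff.1 hc
  · have := h.periodic.int_mul k (Real.arccos (Real.cos x))
    rw [← this]; exact congrArg G (by linarith)
  · have := h.periodic.int_mul k (-Real.arccos (Real.cos x))
    rw [h.1] at this
    rw [← this]; exact congrArg G (by linarith)

theorem sym_reduce (x : ℝ) : ∃ p ∈ Set.Icc (0:ℝ) (Real.pi / 2), ∃ σ : ℝ, |σ| = 1 ∧
    ∀ G : ℝ → ℝ, Sym G → G x = σ * G p := by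
  set y := Real.arccos (Real.cos x) with hy
  have h0 : 0 ≤ y := Real.arccos_nonneg _
  have h1 : y ≤ Real.pi := Real.arccos_le_pi _
  by_cases h : y ≤ Real.pi / 2
  · exact ⟨y, ⟨h0, h⟩, 1, by simp, fun G hG => by rw [one_mul]; exact hG.arccos x⟩
  · refine ⟨Real.pi - y, ⟨by linarith, by linarith⟩, -1, by simp, fun G hG => ?_⟩
    rw [hG.arccos x, ← hy]
    have := hG.2 (-y)
    rw [hG.1, show -y + Real.pi = Real.pi - y by ring] at this
    linarith

theorem Sym.ext {G H : ℝ → ℝ} (hG : Sym G) (hH : Sym H)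
    (h : ∀ x ∈ Set.Icc (0:ℝ) (Real.pi / 2), G x = H x) (x : ℝ) : G x = H x := by
  obtain ⟨p, hp, σ, -, hs⟩ := sym_reduce x
  rw [hs G hG, hs H hH, h p hp]

noncomputable def Ext (f : Y) (x : ℝ) : ℝ :=
  ex f (Real.arccos (Real.cos x)) - ex f (Real.pi - Real.arccos (Real.cos x))

theorem Ext_cont (f : Y) : Continuous (Ext f) := by
  have := ex_cont f
  have h2 := Real.continuous_arccos
  unfold Ext
  fun_prop

theorem Ext_sym (f : Y) : Sym (Ext f) := by
  constructor
  · intro x; simp [Ext]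
  · intro x; simp [Ext, Real.cos_add_pi, Real.arccos_neg]

theorem Ext_eq (f : Y) (hf : ex f (Real.pi / 2) = 0) {x : ℝ}
    (hx : x ∈ Set.Icc (0:ℝ) (Real.pi / 2)) : Ext f x = ex f x := by
  have h1 : Real.arccos (Real.cos x) = x :=
    Real.arccos_cos hx.1 (by linarith [hx.2, Real.pi_pos])
  have h2 : ex f (Real.pi - x) = ex f (Real.pi / 2) := by
    unfold ex
    rw [Set.IccExtend_of_right_le hpi f (by linarith [hx.2]), Set.IccExtend_right]
  rw [Ext, h1, h2, hf, sub_zero]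

theorem prim_odd {g : ℝ → ℝ} (hs : Sym g) (x : ℝ) : prim g (-x) = -prim g x := by
  unfold prim
  have := intervalIntegral.integral_comp_neg (a := 0) (b := x) g
  simp only [hs.1, neg_zero] at this
  rw [this, intervalIntegral.integral_symm]

theorem prim_shift {g : ℝ → ℝ} (hg : Continuous g) (hs : Sym g) (x : ℝ) :
    prim g (x + Real.pi) = -prim g x := by
  have key : ∀ x, prim g (x + Real.pi) = prim g Real.pi - prim g x := by
    intro x
    unfold prim
    rw [← intervalIntegral.integral_add_adjacent_intervals (hg.intervalIntegrable 0 Real.pi)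
      (hg.intervalIntegrable Real.pi (x + Real.pi))]
    have := intervalIntegral.integral_comp_add_right (a := 0) (b := x) g Real.pi
    simp only [hs.2, zero_add] at this
    rw [← this, intervalIntegral.integral_neg]; ring
  have h1 := key (-(Real.pi / 2))
  have h2 := prim_odd hs (Real.pi / 2)
  rw [h2, show -(Real.pi / 2) + Real.pi = Real.pi / 2 by ring] at h1
  rw [key]
  linarith

theorem prim_nat {g : ℝ → ℝ} (hg : Continuous g) (hs : Sym g) (n : ℕ) :
    prim g (n * Real.pi) = 0 := by
  induction n with
  | zero => simp [prim_zero]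
  | succ k ih =>
    rw [show ((k + 1 : ℕ) : ℝ) * Real.pi = k * Real.pi + Real.pi by push_cast; ring,
      prim_shift hg hs, ih, neg_zero]

theorem Tf_sym {g : ℝ → ℝ} (hg : Continuous g) (hs : Sym g) : Sym (Tf g) := by
  have hp := prim_cont hg
  have hsplit : ∀ x y, Tf g x = (∫ z in x..y, prim g z) + Tf g y := fun x y =>
    (intervalIntegral.integral_add_adjacent_intervals (hp.intervalIntegrable _ _)
      (hp.intervalIntegrable _ _)).symm
  have heven : ∀ x, Tf g (-x) = Tf g x := by
    intro x
    rw [hsplit (-x) x]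
    have := intervalIntegral.integral_comp_neg (a := -x) (b := x) (prim g)
    simp only [prim_odd hs, neg_neg, intervalIntegral.integral_neg] at this
    have : (∫ z in (-x)..x, prim g z) = 0 := by linarith
    rw [this, zero_add]
  refine ⟨heven, fun x => ?_⟩
  rw [hsplit (x + Real.pi) (-(Real.pi / 2) + Real.pi)]
  have := intervalIntegral.integral_comp_add_right (a := x) (b := -(Real.pi / 2)) (prim g) Real.pi
  simp only [prim_shift hg hs, intervalIntegral.integral_neg] at this
  rw [← this, show -(Real.pi / 2) + Real.pi = Real.pi / 2 by ring, Tf_end,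
    hsplit x (-(Real.pi / 2)), heven, Tf_end]
  ring

theorem deriv_scaled {g : ℝ → ℝ} (hg : Continuous g) (k A B : ℝ) :
    deriv (fun x => A + B * Tf g (k * x)) = fun x => B * (-prim g (k * x) * k) := by
  funext x
  have hlin : HasDerivAt (fun x : ℝ => k * x) k x := by
    simpa using (hasDerivAt_id x).const_mul k
  exact ((((Tf_deriv hg (k * x)).comp x hlin).const_mul B).const_add A).deriv

theorem hasDeriv2_scaled {g : ℝ → ℝ} (hg : Continuous g) (k B x : ℝ) :
    HasDerivAt (fun x => B * (-prim g (k * x) * k)) (B * (-(g (k * x) * k) * k)) x := by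
  have hlin : HasDerivAt (fun x : ℝ => k * x) k x := by
    simpa using (hasDerivAt_id x).const_mul k
  exact ((((prim_deriv hg (k * x)).comp x hlin).neg).mul_const k).const_mul B

theorem contDiff_scaled {g : ℝ → ℝ} (hg : Continuous g) (k A B : ℝ) :
    ContDiff ℝ 2 (fun x => A + B * Tf g (k * x)) := by
  have h1 : ContDiff ℝ 1 (prim g) := by
    rw [contDiff_one_iff_deriv]
    refine ⟨fun x => (prim_deriv hg x).differentiableAt, ?_⟩
    rw [show deriv (prim g) = g from funext fun x => (prim_deriv hg x).deriv]
    exact hg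
  have h2 : ContDiff ℝ 2 (Tf g) := by
    rw [show (2 : WithTop ℕ∞) = 1 + 1 by norm_num, contDiff_succ_iff_deriv]
    refine ⟨fun x => (Tf_deriv hg x).differentiableAt, by simp, ?_⟩
    rw [show deriv (Tf g) = fun x => -prim g x from funext fun x => (Tf_deriv hg x).deriv]
    exact h1.neg
  fun_prop

theorem int_scaled {g : ℝ → ℝ} (hg : Continuous g) (hs : Sym g) (n : ℕ) (hn : 1 ≤ n) :
    ∫ x in (-1:ℝ)..1, g ((n * Real.pi) * x) = 0 := by
  have hk : (n * Real.pi : ℝ) ≠ 0 := by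
    have : (n:ℝ) ≠ 0 := by positivity
    have := Real.pi_pos
    positivity
  rw [intervalIntegral.integral_comp_mul_left g hk]
  have : ∫ x in ((n * Real.pi : ℝ) * -1)..((n * Real.pi) * 1), g x = 0 := by
    have := intervalIntegral.integral_interval_sub_left (μ := MeasureTheory.volume)
      (hg.intervalIntegrable 0 (n * Real.pi * 1))
      (hg.intervalIntegrable 0 ((n * Real.pi) * -1))
    rw [← this]
    change prim g _ - prim g _ = 0
    rw [mul_neg_one, mul_one, prim_odd hs, prim_nat hg hs]; simp
  rw [this, smul_zero]

end ACOK

theorem acok_bifurcation_cosine_branch (n : ℕ) (hn : 1 ≤ n) :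
    ∃ ε₀ > (0 : ℝ), ∀ ε : ℝ, 0 < ε → ε < ε₀ →
      ∃ δ > (0 : ℝ), ∃ γ : ℝ → ℝ,
        ContinuousOn γ (Set.Ioo (-δ) δ) ∧
        γ 0 = -ε * (n * Real.pi) ^ 4 + (18 / ε) * (n * Real.pi) ^ 2 ∧
        ∃ η : ℝ → ℝ, (∀ s : ℝ, 0 ≤ η s) ∧
          Filter.Tendsto η (nhds 0) (nhds 0) ∧
          ∃ φ : ℝ → ℝ → ℝ, ∃ u : ℝ → ℝ → ℝ, ∀ s ∈ Set.Ioo (-δ) δ,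
            ContDiff ℝ 2 (φ s) ∧ ContDiff ℝ 2 (u s) ∧
            (∀ x ∈ Set.Ioo (-1 : ℝ) 1,
              ε * deriv (deriv (φ s)) x
                - (1 / ε) * (36 * (2 * (φ s x) ^ 3 - 3 * (φ s x) ^ 2 + φ s x))
                - γ s * u s x = 0) ∧
            (∀ x ∈ Set.Ioo (-1 : ℝ) 1,
              -(deriv (deriv (u s)) x) = φ s x - (1 / 2) * ∫ y in (-1 : ℝ)..1, φ s y) ∧
            deriv (φ s) (-1) = 0 ∧ deriv (φ s) 1 = 0 ∧
            deriv (u s) (-1) = 0 ∧ deriv (u s) 1 = 0 ∧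
            (∫ x in (-1 : ℝ)..1, u s x) = 0 ∧
            (∀ x ∈ Set.Icc (-1 : ℝ) 1,
              |φ s x - 1 / 2 - s * Real.cos (n * Real.pi * x)| ≤ η s * |s|) := by
  have hpos : (0:ℝ) < n * Real.pi := by
    have : (0:ℝ) < n := by exact_mod_cast hn
    have := Real.pi_pos
    positivity
  set k : ℝ := n * Real.pi with hk
  refine ⟨1 / k, by positivity, fun ε hε hε1 => ?_⟩
  have hek : ε * k < 1 := by rwa [lt_div_iff₀ hpos] at hε1
  have hek2 : ε ^ 2 * k ^ 2 < 1 := by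
    rw [← mul_pow]; exact pow_lt_one₀ (by positivity) hek (by norm_num)
  set a : ℝ := 18 / (ε ^ 2 * k ^ 2) with ha
  have ha10 : 10 < a := by
    rw [ha, lt_div_iff₀ (by positivity)]; linarith
  obtain ⟨δ, hδ, ν, w, hν, hw0, hwc, hmain⟩ := ACOK.branch a ha10
  let V : ℝ → ACOK.Y := fun s => s • (ACOK.cs 1 + w s)
  let g : ℝ → ℝ := fun s => a - 1 + s ^ 2 * ν s
  let h : ℝ → ACOK.Y := fun s => a • V s - (4 * a) • (V s * V s * V s) - g s • ACOK.T (V s)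
  refine ⟨δ, hδ, fun s => ε * k ^ 4 * g s, ?_, ?_, fun s => ‖w s‖, fun s => norm_nonneg _, ?_,
    fun s x => 1 / 2 + 1 * ACOK.Tf (ACOK.Ext (h s)) (k * x),
    fun s x => 0 + (1 / k ^ 2) * ACOK.Tf (ACOK.Ext (V s)) (k * x), ?_⟩
  · have : ContinuousOn g (Set.Ioo (-δ) δ) := by fun_prop
    fun_prop
  · simp only [g, ha]; field_simp; ring
  · have := hwc.norm.tendsto
    simpa [hw0] using this
  intro s hs
  have hV : V s = ACOK.T (h s) := hmain s hs (V s) rfl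
  have hend : Real.pi / 2 ∈ Set.Icc (0:ℝ) (Real.pi / 2) := Set.right_mem_Icc.2 ACOK.hpi
  have hT0 : ∀ f, ACOK.ex (ACOK.T f) (Real.pi / 2) = 0 := fun f => by
    rw [ACOK.ex_T f hend, ACOK.Tf_end]
  have hV0 : ACOK.ex (V s) (Real.pi / 2) = 0 := by rw [hV]; exact hT0 _
  have hexh : ∀ x, ACOK.ex (h s) x = a * ACOK.ex (V s) x
      - 4 * a * (ACOK.ex (V s) x * ACOK.ex (V s) x * ACOK.ex (V s) x)
      - g s * ACOK.ex (ACOK.T (V s)) x := fun x => rfl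
  have hh0 : ACOK.ex (h s) (Real.pi / 2) = 0 := by rw [hexh, hV0, hT0]; simp
  have cV := ACOK.Ext_cont (V s)
  have ch := ACOK.Ext_cont (h s)
  have sV := ACOK.Ext_sym (V s)
  have sh := ACOK.Ext_sym (h s)
  have sTV := ACOK.Tf_sym cV sV
  have sTh := ACOK.Tf_sym ch sh
  have Tf_Ext : ∀ f, ACOK.ex f (Real.pi / 2) = 0 → ∀ x ∈ Set.Icc (0:ℝ) (Real.pi / 2),
      ACOK.Tf (ACOK.Ext f) x = ACOK.ex (ACOK.T f) x := by
    intro f hf x hx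
    rw [ACOK.ex_T f hx]
    apply intervalIntegral.integral_congr
    intro y hy
    rw [Set.uIcc_of_le hx.2] at hy
    apply intervalIntegral.integral_congr
    intro z hz
    rw [Set.uIcc_of_le (hx.1.trans hy.1)] at hz
    exact ACOK.Ext_eq f hf ⟨hz.1, hz.2.trans hy.2⟩
  -- the profile solves the fixed point equation on the whole line
  have e1 : ∀ x, ACOK.Tf (ACOK.Ext (h s)) x = ACOK.Ext (V s) x := by
    apply ACOK.Sym.ext sTh sV
    intro x hx
    rw [Tf_Ext _ hh0 x hx, ACOK.Ext_eq _ hV0 hx, ← hV]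
  have e2 : ∀ x, ACOK.Ext (h s) x = a * ACOK.Ext (V s) x
      - 4 * a * (ACOK.Ext (V s) x) ^ 3 - g s * ACOK.Tf (ACOK.Ext (V s)) x := by
    apply ACOK.Sym.ext sh
    · constructor
      · intro x; simp only [sV.1, sTV.1]
      · intro x; simp only [sV.2, sTV.2]; ring
    · intro x hx
      rw [ACOK.Ext_eq _ hh0 hx, ACOK.Ext_eq _ hV0 hx, Tf_Ext _ hV0 x hx, hexh]; ring
  refine ⟨ACOK.contDiff_scaled ch _ _ _, ACOK.contDiff_scaled cV _ _ _, ?_, ?_, ?_, ?_, ?_, ?_,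
    ?_, ?_⟩
  · intro x _
    beta_reduce
    rw [ACOK.deriv_scaled ch, (ACOK.hasDeriv2_scaled ch k 1 x).deriv, e1, e2]
    generalize ACOK.Ext (V s) (k * x) = v
    generalize ACOK.Tf (ACOK.Ext (V s)) (k * x) = t
    simp only [ha]
    field_simp
    ring
  · intro x _
    have hint : ∫ y in (-1 : ℝ)..1, (1 / 2 + 1 * ACOK.Tf (ACOK.Ext (h s)) (k * y)) = 1 := by
      rw [intervalIntegral.integral_add, intervalIntegral.integral_const_mul, hk,
        ACOK.int_scaled (ACOK.Tf_cont ch) sTh n hn]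
      · norm_num
      · apply Continuous.intervalIntegrable; fun_prop
      · apply Continuous.intervalIntegrable
        have := ACOK.Tf_cont ch
        fun_prop
    beta_reduce
    rw [hint, ACOK.deriv_scaled cV, (ACOK.hasDeriv2_scaled cV k _ x).deriv, e1]
    field_simp
    ring
  · rw [ACOK.deriv_scaled ch]; beta_reduce; rw [mul_neg_one k, ACOK.prim_odd sh, hk, ACOK.prim_nat ch sh]; simp
  · rw [ACOK.deriv_scaled ch]; beta_reduce; rw [mul_one k, hk, ACOK.prim_nat ch sh]; simp
  · rw [ACOK.deriv_scaled cV]; beta_reduce; rw [mul_neg_one k, ACOK.prim_odd sV, hk, ACOK.prim_nat cV sV]; simp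
  · rw [ACOK.deriv_scaled cV]; beta_reduce; rw [mul_one k, hk, ACOK.prim_nat cV sV]; simp
  · simp only [zero_add]
    rw [intervalIntegral.integral_const_mul, hk, ACOK.int_scaled (ACOK.Tf_cont cV) sTV n hn,
      mul_zero]
  · intro x _
    have hS : ACOK.Sym (fun y => ACOK.Ext (V s) y - s * Real.cos y) := by
      constructor
      · intro y; simp [sV.1]
      · intro y; simp [sV.2]; ring
    obtain ⟨p, hp, σ, hσ, hr⟩ := ACOK.sym_reduce (k * x)
    have := hr _ hS
    simp only [ACOK.Ext_eq _ hV0 hp] at this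
    beta_reduce
    rw [e1, show 1 / 2 + 1 * ACOK.Ext (V s) (k * x) - 1 / 2 - s * Real.cos (k * x) =
      ACOK.Ext (V s) (k * x) - s * Real.cos (k * x) by ring, this, abs_mul, hσ, one_mul]
    have hVp : ACOK.ex (V s) p = s * (Real.cos p + ACOK.ex (w s) p) := by
      have h1 : ACOK.ex (V s) p = s * (ACOK.ex (ACOK.cs 1) p + ACOK.ex (w s) p) := rfl
      rw [h1, ACOK.ex_cs 1 hp, one_mul]
    rw [hVp, show s * (Real.cos p + ACOK.ex (w s) p) - s * Real.cos p = ACOK.ex (w s) p * s by ring,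
      abs_mul]
    gcongr
    exact ACOK.ex_le _ _
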